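/- In the free group F₂ on α, β, the number of elements of word length at most n that are conjugates of powers of α, β, or αβ equals 10·3^r − 6 if n = 2r+1 and 2·3^(r+1) − 6 if n = 2r (for n ≥ 0 even, interpreting the count appropriately; in particular, it equals 0 when n = 0). -/

import Mathlib

abbrev F2 := FreeGroup (Fin 2)

def α : F2 := FreeGroup.of 0

def β : F2 := FreeGroup.of 1

/-- Number of reducible-type elements of word length at most `n`. -/
noncomputable def redBall (n : ℕ) : ℕ :=
  Nat.card {g : F2 | FreeGroup.norm g ≤ n ∧
    ∃ (w : F2) (k : ℤ) (γ : F2), k ≠ 0 ∧ γ ∈ ({α, β, α * β} : Set F2) ∧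
      g = w * γ ^ k * w⁻¹}

namespace RB

open FreeGroup

abbrev Ltr := Fin 2 × Bool

/-- the inverse letter -/
def iv (x : Ltr) : Ltr := (x.1, !x.2)

/-- the alternating word `p q p q …` of length `n` -/
def alt : ℕ → Ltr → Ltr → List Ltr
  | 0, _, _ => []
  | n + 1, p, q => p :: alt n q p

def good (n : ℕ) (p q : Ltr) : Prop := p.2 = q.2 ∧ (p.1 = q.1 ∨ Even n)

instance (n : ℕ) (p q : Ltr) : Decidable (good n p q) := by unfold good; infer_instance

/-- reduced words representing the conjugates -/
inductive Rw : List Ltr → Prop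
  | core (n : ℕ) (p q : Ltr) : good (n + 1) p q → Rw (alt (n + 1) p q)
  | conj (x : Ltr) (L : List Ltr) : Rw L → IsReduced (x :: (L ++ [iv x])) →
      Rw (x :: (L ++ [iv x]))

lemma alt_length (n : ℕ) (p q : Ltr) : (alt n p q).length = n := by
  induction n generalizing p q with
  | zero => rfl
  | succ n ih => simp [alt, ih]

lemma alt_reduced (n : ℕ) (p q : Ltr) (h : p.2 = q.2) : IsReduced (alt n p q) := by
  induction n generalizing p q with
  | zero => simp [alt]
  | succ n ih =>
    have := ih q p h.symm
    unfold FreeGroup.IsReduced at *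
    rw [alt, List.isChain_cons]
    refine ⟨?_, this⟩
    intro y hy _
    cases n with
    | zero => simp [alt] at hy
    | succ n => simp [alt] at hy; rw [← hy, h]

lemma alt_snoc (n : ℕ) (p q : Ltr) :
    alt (n + 1) p q = alt n p q ++ [if Even n then p else q] := by
  induction n generalizing p q with
  | zero => simp [alt]
  | succ n ih =>
    rw [alt, ih q p]
    by_cases h : Even n <;> simp [alt, h, Nat.even_add_one]

lemma good_symm {n : ℕ} {p q : Ltr} (h : good n p q) : good n q p :=
  ⟨h.1.symm, h.2.imp Eq.symm id⟩

lemma alt_snoc_good {n : ℕ} {p q : Ltr} (h : good (n + 1) p q) :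
    alt (n + 1) p q = alt n p q ++ [q] := by
  rw [alt_snoc]
  rcases h with ⟨h1, h2 | h2⟩
  · have : p = q := Prod.ext h2 h1
    simp [this]
  · rw [Nat.even_add_one] at h2
    simp [h2]

lemma Rw.reduced {L : List Ltr} (h : Rw L) : IsReduced L := by
  cases h with
  | core n p q h => exact alt_reduced _ _ _ h.1
  | conj x L _ h => exact h

lemma tw {L : List Ltr} (h : IsReduced L) : toWord (mk L) = L := by
  rw [toWord_mk, h.reduce_eq]

lemma red_iff {L : List Ltr} (hL : IsReduced L) {p q : Ltr} (hp : L.head? = some p)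
    (hq : L.getLast? = some q) (x : Ltr) :
    IsReduced (x :: (L ++ [iv x])) ↔ x ≠ iv p ∧ x ≠ q := by
  unfold FreeGroup.IsReduced at *
  rw [List.isChain_cons, List.isChain_append]
  have hne : L ≠ [] := by rintro rfl; simp at hp
  simp only [List.head?_append, hp, hq, hL, true_and]
  simp only [Option.some_or, Option.mem_some_iff, forall_eq', List.isChain_singleton, true_and,
    List.head?_cons]
  clear hne hL hp hq
  revert p q x
  decide

lemma mk_iv (x : Ltr) : (mk [iv x] : F2) = (mk [x])⁻¹ := by
  simp [iv, inv_mk, invRev]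

lemma Rw.closed {L : List Ltr} (h : Rw L) (x : Ltr) :
    Rw (toWord (mk [x] * mk L * (mk [x])⁻¹ : F2)) := by
  have key : ∀ (p q : Ltr), L.head? = some p → L.getLast? = some q → x ≠ iv p → x ≠ q →
      Rw (toWord (mk [x] * mk L * (mk [x])⁻¹ : F2)) := by
    intro p q hp hq h1 h2
    have hr := (red_iff h.reduced hp hq x).2 ⟨h1, h2⟩
    have : (mk [x] * mk L * (mk [x])⁻¹ : F2) = mk (x :: (L ++ [iv x])) := by
      rw [← mk_iv]; simp [mul_mk]
    rw [this, tw hr]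
    exact Rw.conj x L h hr
  cases h with
  | core n p q hg =>
    have e1 : alt (n + 1) p q = [p] ++ alt n q p := rfl
    have e2 := alt_snoc_good hg
    have e3 : alt (n + 1) q p = [q] ++ alt n p q := rfl
    have e4 := alt_snoc_good (good_symm hg)
    have hR : Rw (toWord (mk (alt (n + 1) q p) : F2)) := by
      rw [tw (alt_reduced _ _ _ hg.1.symm)]
      exact Rw.core n q p (good_symm hg)
    by_cases h1 : x = iv p
    · have : (mk [x] * mk (alt (n + 1) p q) * (mk [x])⁻¹ : F2) = mk (alt (n + 1) q p) := by
        rw [e4, e1, h1, mk_iv, ← mul_mk, ← mul_mk]; group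
      rwa [this]
    by_cases h2 : x = q
    · have : (mk [x] * mk (alt (n + 1) p q) * (mk [x])⁻¹ : F2) = mk (alt (n + 1) q p) := by
        rw [e3, e2, h2, ← mul_mk, ← mul_mk]; group
      rwa [this]
    exact key p q (by simp [e1]) (by simp [e2]) h1 h2
  | conj y L hL hr =>
    by_cases h1 : x = iv y
    · have : (mk [x] * mk (y :: (L ++ [iv y])) * (mk [x])⁻¹ : F2) = mk L := by
        have : y :: (L ++ [iv y]) = [y] ++ L ++ [iv y] := by simp
        rw [this, ← mul_mk, ← mul_mk, h1, mk_iv]; group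
      rw [this, tw hL.reduced]; exact hL
    · exact key y (iv y) (by simp) (by rw [← List.cons_append, List.getLast?_concat]) h1 h1

lemma mk_alt_self (n : ℕ) (p : Ltr) : (mk (alt n p p) : F2) = mk [p] ^ n := by
  induction n with
  | zero => rfl
  | succ n ih =>
    rw [pow_succ', ← ih, mul_mk]; rfl

lemma mk_alt_two (n : ℕ) (p q : Ltr) : (mk (alt (2 * n) p q) : F2) = (mk [p] * mk [q]) ^ n := by
  induction n with
  | zero => rfl
  | succ n ih =>
    rw [pow_succ', ← ih, mul_mk, mul_mk]; rfl

def Cj (g : F2) : Prop := ∃ (w : F2) (k : ℤ) (γ : F2), k ≠ 0 ∧ γ ∈ ({α, β, α * β} : Set F2) ∧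
      g = w * γ ^ k * w⁻¹

lemma Rw_pow (p : Ltr) (n : ℕ) : Rw (toWord (mk [p] ^ (n + 1) : F2)) := by
  rw [← mk_alt_self, tw (alt_reduced _ _ _ rfl)]
  exact Rw.core n p p ⟨rfl, Or.inl rfl⟩

lemma Rw_pow2 (p q : Ltr) (h : p.2 = q.2) (n : ℕ) :
    Rw (toWord ((mk [p] * mk [q]) ^ (n + 1) : F2)) := by
  rw [← mk_alt_two, tw (alt_reduced _ _ _ h)]
  exact Rw.core (2 * n + 1) p q ⟨h, Or.inr ⟨n + 1, by ring⟩⟩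

lemma Rw_zpow {γ : F2} (hγ : γ ∈ ({α, β, α * β} : Set F2)) {k : ℤ} (hk : k ≠ 0) :
    Rw (toWord (γ ^ k)) := by
  have ha : α = mk [((0 : Fin 2), true)] := rfl
  have hb : β = mk [((1 : Fin 2), true)] := rfl
  have key : ∀ n : ℕ, Rw (toWord (γ ^ (n + 1))) ∧ Rw (toWord (γ⁻¹ ^ (n + 1))) := by
    intro n
    rcases hγ with h | h | h
    · rw [h, ha, ← mk_iv]; exact ⟨Rw_pow _ _, Rw_pow _ _⟩
    · rw [h, hb, ← mk_iv]; exact ⟨Rw_pow _ _, Rw_pow _ _⟩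
    · rw [Set.mem_singleton_iff.1 h, mul_inv_rev, ha, hb, ← mk_iv, ← mk_iv]
      exact ⟨Rw_pow2 (0, true) (1, true) rfl n,
        Rw_pow2 (iv (1, true)) (iv (0, true)) rfl n⟩
  rcases k with n | n
  · cases n with
    | zero => simp at hk
    | succ n =>
      have := (key n).1
      rwa [← zpow_natCast] at this
  · have := (key n).2
    rwa [inv_pow, ← zpow_negSucc] at this

lemma Cj.rw {g : F2} (h : Cj g) : Rw (toWord g) := by
  obtain ⟨w, k, γ, hk, hγ, rfl⟩ := h
  have key : ∀ (L : List Ltr) , Rw (toWord (mk L * γ ^ k * (mk L)⁻¹ : F2)) := by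
    intro L
    induction L with
    | nil => simpa [← one_eq_mk] using Rw_zpow hγ hk
    | cons x L ih =>
      have h := Rw.closed ih x
      rw [mk_toWord] at h
      have e : (mk (x :: L) : F2) = mk [x] * mk L := by rw [mul_mk]; rfl
      rw [e, mul_inv_rev]
      simpa only [mul_assoc] using h
  have := key (toWord w)
  rwa [mk_toWord] at this

lemma Cj.conj {g : F2} (h : Cj g) (x : F2) : Cj (x * g * x⁻¹) := by
  obtain ⟨w, k, γ, hk, hγ, rfl⟩ := h
  exact ⟨x * w, k, γ, hk, hγ, by group⟩

lemma Cj_pow (p : Ltr) (n : ℕ) : Cj (mk [p] ^ (n + 1)) := by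
  obtain ⟨i, b⟩ := p
  have hγ : (mk [(i, true)] : F2) ∈ ({α, β, α * β} : Set F2) := by
    fin_cases i
    · left; rfl
    · right; left; rfl
  cases b
  · refine ⟨1, Int.negSucc n, mk [(i, true)], by simp, hγ, ?_⟩
    have : (mk [(i, false)] : F2) = (mk [(i, true)])⁻¹ := mk_iv (i, true)
    rw [this, zpow_negSucc, inv_pow, one_mul, inv_one, mul_one]
  · refine ⟨1, (n + 1 : ℕ), mk [(i, true)], by omega, hγ, ?_⟩
    rw [zpow_natCast]; simp

lemma Cj_ab (k : ℤ) (hk : k ≠ 0) : Cj ((α * β) ^ k) := ⟨1, k, α * β, hk, by simp, by simp⟩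

lemma Cj_ba (k : ℤ) (hk : k ≠ 0) : Cj ((β * α) ^ k) :=
  ⟨β, k, α * β, hk, by simp, by rw [← conj_zpow]; congr 1; group⟩

lemma Cj_pow2 (p q : Ltr) (h : p.2 = q.2) (h' : p.1 ≠ q.1) (n : ℕ) :
    Cj ((mk [p] * mk [q]) ^ (n + 1)) := by
  have ha : mk [((0 : Fin 2), true)] = α := rfl
  have hb : mk [((1 : Fin 2), true)] = β := rfl
  have ha' : mk [((0 : Fin 2), false)] = α⁻¹ := mk_iv (0, true)
  have hb' : mk [((1 : Fin 2), false)] = β⁻¹ := mk_iv (1, true)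
  have c1 := Cj_ab (n + 1 : ℕ) (by omega)
  have c2 := Cj_ba (n + 1 : ℕ) (by omega)
  have c3 := Cj_ab (Int.negSucc n) (by simp)
  have c4 := Cj_ba (Int.negSucc n) (by simp)
  rw [zpow_natCast] at c1 c2
  rw [zpow_negSucc, ← inv_pow, mul_inv_rev] at c3 c4
  obtain ⟨i, b⟩ := p
  obtain ⟨j, c⟩ := q
  simp only at h h'
  subst h
  fin_cases i <;> fin_cases j <;> cases b <;> simp at h' <;>
    simp only [Fin.mk_zero, Fin.mk_one, Fin.zero_eta, ha, hb, ha', hb'] <;> assumption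

lemma Rw.cj {L : List Ltr} (h : Rw L) : Cj (mk L) := by
  induction h with
  | core n p q h =>
    by_cases h1 : p.1 = q.1
    · have : p = q := Prod.ext h1 h.1
      subst this
      rw [mk_alt_self]; exact Cj_pow _ _
    · obtain ⟨m, hm⟩ := h.2.resolve_left h1
      obtain ⟨m, rfl⟩ : ∃ j, m = j + 1 := ⟨m - 1, by omega⟩
      rw [hm, ← two_mul, mk_alt_two]
      exact Cj_pow2 p q h.1 h1 m
  | conj x L _ _ ih =>
    have : (mk (x :: (L ++ [iv x])) : F2) = mk [x] * mk L * (mk [x])⁻¹ := by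
      rw [← mk_iv]; simp [mul_mk]
    rw [this]; exact ih.conj _

lemma Cj_iff (g : F2) : Cj g ↔ Rw (toWord g) :=
  ⟨Cj.rw, fun h => by simpa [mk_toWord] using h.cj⟩

/-! Counting -/

open Classical in
noncomputable def C : ℕ → Finset (List Ltr)
  | 0 => ∅
  | n + 1 => (Finset.univ.filter fun p : Ltr × Ltr => good (n + 1) p.1 p.2).image
      fun p => alt (n + 1) p.1 p.2

open Classical in
noncomputable def N : ℕ → Finset (List Ltr)
  | 0 => ∅
  | 1 => ∅
  | n + 2 => (((C n ∪ N n) ×ˢ Finset.univ).filter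
      fun p : List Ltr × Ltr => IsReduced (p.2 :: (p.1 ++ [iv p.2]))).image
      fun p => p.2 :: (p.1 ++ [iv p.2])

lemma mem_C {n : ℕ} {L : List Ltr} : L ∈ C n ↔ ∃ m p q, n = m + 1 ∧ good (m + 1) p q ∧
    L = alt (m + 1) p q := by
  cases n with
  | zero => simp [C]
  | succ n =>
    simp only [C, Finset.mem_image, Finset.mem_filter, Finset.mem_univ, true_and]
    constructor
    · rintro ⟨⟨p, q⟩, h, rfl⟩; exact ⟨n, p, q, rfl, h, rfl⟩
    · rintro ⟨m, p, q, h, hg, rfl⟩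
      obtain rfl : n = m := by omega
      exact ⟨⟨p, q⟩, hg, rfl⟩

lemma mem_N {n : ℕ} {L : List Ltr} : L ∈ N (n + 2) ↔ ∃ M x, (M ∈ C n ∨ M ∈ N n) ∧
    IsReduced (x :: (M ++ [iv x])) ∧ L = x :: (M ++ [iv x]) := by
  simp only [N, Finset.mem_image, Finset.mem_filter, Finset.mem_univ, Finset.mem_product,
    Finset.mem_union, and_true]
  constructor
  · rintro ⟨⟨M, x⟩, ⟨h, h2⟩, rfl⟩; exact ⟨M, x, h, h2, rfl⟩
  · rintro ⟨M, x, h, h2, rfl⟩; exact ⟨⟨M, x⟩, ⟨h, h2⟩, rfl⟩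

lemma mem_T (n : ℕ) : ∀ L : List Ltr, L ∈ C n ∪ N n ↔ Rw L ∧ L.length = n := by
  induction n using Nat.strong_induction_on with
  | _ n ih =>
  intro L
  rw [Finset.mem_union]
  constructor
  · rintro (h | h)
    · obtain ⟨m, p, q, rfl, hg, rfl⟩ := mem_C.1 h
      exact ⟨Rw.core _ _ _ hg, alt_length _ _ _⟩
    · match n, ih, h with
      | 0, _, h => simp [N] at h
      | 1, _, h => simp [N] at h
      | n + 2, ih, h =>
        obtain ⟨M, x, hM, hr, rfl⟩ := mem_N.1 h
        have := (ih n (by omega) M).1 (Finset.mem_union.2 hM)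
        exact ⟨Rw.conj _ _ this.1 hr, by simp [this.2]⟩
  · rintro ⟨h, hl⟩
    cases h with
    | core m p q hg =>
      rw [alt_length] at hl
      exact Or.inl (mem_C.2 ⟨m, p, q, hl.symm, hg, rfl⟩)
    | conj x M hM hr =>
      right
      have : n = M.length + 2 := by simp at hl; omega
      subst this
      exact mem_N.2 ⟨M, x, Finset.mem_union.1 ((ih _ (by omega) M).2 ⟨hM, rfl⟩), hr, rfl⟩

lemma C_ends {n : ℕ} {L : List Ltr} (h : L ∈ C n) : IsReduced L ∧ ∃ p q, L.head? = some p ∧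
    L.getLast? = some q ∧ q ≠ iv p := by
  obtain ⟨m, p, q, rfl, hg, rfl⟩ := mem_C.1 h
  refine ⟨alt_reduced _ _ _ hg.1, p, q, by simp [alt], by rw [alt_snoc_good hg]; simp, ?_⟩
  rintro rfl
  have := hg.1
  simp [iv] at this

lemma N_ends {n : ℕ} {L : List Ltr} (h : L ∈ N n) : IsReduced L ∧ ∃ p q, L.head? = some p ∧
    L.getLast? = some q ∧ q = iv p := by
  match n, h with
  | 0, h => simp [N] at h
  | 1, h => simp [N] at h
  | n + 2, h =>
    obtain ⟨M, x, hM, hr, rfl⟩ := mem_N.1 h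
    exact ⟨hr, x, iv x, by simp, by rw [← List.cons_append, List.getLast?_concat], rfl⟩

lemma disj (n : ℕ) : Disjoint (C n) (N n) := by
  rw [Finset.disjoint_left]
  intro L h1 h2
  obtain ⟨_, p, q, hp, hq, h⟩ := C_ends h1
  obtain ⟨_, p', q', hp', hq', h'⟩ := N_ends h2
  rw [hp] at hp'; rw [hq] at hq'
  simp only [Option.some.injEq] at hp' hq'
  subst hp' hq'
  exact h h'

lemma cnt : ∀ p q : Ltr, (Finset.univ.filter fun x : Ltr => x ≠ iv p ∧ x ≠ q).card =
    if q = iv p then 3 else 2 := by decide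

lemma card_N (n : ℕ) : (N (n + 2)).card = 2 * (C n).card + 3 * (N n).card := by
  classical
  rw [N, Finset.card_image_of_injective, Finset.card_filter, Finset.sum_product,
    Finset.sum_union (disj n)]
  · congr 1
    · rw [mul_comm, ← smul_eq_mul]
      apply Finset.sum_const_nat
      intro L hL
      obtain ⟨hr, p, q, hp, hq, h⟩ := C_ends hL
      simp only [red_iff hr hp hq]
      rw [← Finset.card_filter, cnt, if_neg h]
    · rw [mul_comm, ← smul_eq_mul]
      apply Finset.sum_const_nat
      intro L hL
      obtain ⟨hr, p, q, hp, hq, h⟩ := N_ends hL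
      simp only [red_iff hr hp hq]
      rw [← Finset.card_filter, cnt, if_pos h]
  · rintro ⟨M, x⟩ ⟨M', x'⟩ h
    simp only [List.cons.injEq] at h
    obtain ⟨rfl, h⟩ := h
    rw [List.append_cancel_right h]

lemma card_C (n : ℕ) : (C (n + 1)).card = if Even (n + 1) then 8 else 4 := by
  rw [C, Finset.card_image_of_injOn]
  · by_cases h : Even (n + 1)
    · simp only [good, h, or_true, and_true, if_true]; decide
    · simp only [good, h, or_false, if_false]; decide
  · rintro ⟨p, q⟩ h ⟨p', q'⟩ h' e
    simp only [Finset.coe_filter, Finset.mem_univ, true_and, Set.mem_ofPred_eq] at h h'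
    have e' : alt (n + 1) p q = alt (n + 1) p' q' := e
    have e1 := congrArg List.head? e'
    rw [alt_snoc_good h, alt_snoc_good h'] at e'
    have e2 := congrArg List.getLast? e'
    simp [alt] at e1
    simp at e2
    rw [e1, e2]

lemma redBall_eq (n : ℕ) : redBall n = ∑ i ∈ Finset.range (n + 1), ((C i).card + (N i).card) := by
  classical
  have h1 : redBall n = Nat.card ((Finset.range (n + 1)).biUnion fun i => C i ∪ N i) := by
    unfold redBall
    apply Nat.card_congr
    refine Equiv.ofBijective (fun g => ⟨toWord g.1, ?_⟩) ⟨?_, ?_⟩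
    · obtain ⟨g, hg, hc⟩ := g
      have hc' := (Cj_iff g).1 hc
      rw [Finset.mem_biUnion]
      exact ⟨g.norm, by simpa [Nat.lt_succ_iff] using hg, (mem_T _ _).2 ⟨hc', rfl⟩⟩
    · intro a b h
      exact Subtype.ext (toWord_injective (congrArg Subtype.val h))
    · rintro ⟨L, hL⟩
      rw [Finset.mem_biUnion] at hL
      obtain ⟨i, hi, hL⟩ := hL
      obtain ⟨hR, hl⟩ := (mem_T _ _).1 hL
      have ht := tw hR.reduced
      refine ⟨⟨mk L, ?_, hR.cj⟩, Subtype.ext ht⟩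
      rw [FreeGroup.norm, ht, hl]
      simp at hi; omega
  rw [h1, Nat.card_eq_fintype_card, Fintype.card_coe, Finset.card_biUnion]
  · exact Finset.sum_congr rfl fun i _ => Finset.card_union_of_disjoint (disj i)
  · intro i _ j _ hij
    rw [Function.onFun, Finset.disjoint_left]
    intro L hL hL'
    exact hij (((mem_T _ _).1 hL).2.symm.trans ((mem_T _ _).1 hL').2)

lemma N_odd (r : ℕ) : (N (2 * r + 1)).card + 4 = 4 * 3 ^ r := by
  induction r with
  | zero => simp [N]
  | succ r ih =>
    have := card_N (2 * r + 1)
    rw [card_C, if_neg (by simp [Nat.even_add_one])] at this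
    rw [show 2 * (r + 1) + 1 = 2 * r + 1 + 2 by ring, this, pow_succ]; omega

lemma N_even (r : ℕ) : (N (2 * r + 2)).card + 8 = 8 * 3 ^ r := by
  induction r with
  | zero => rw [card_N]; simp [N, C]
  | succ r ih =>
    have := card_N (2 * r + 2)
    rw [card_C, if_pos (by simp [Nat.even_add_one])] at this
    rw [show 2 * (r + 1) + 2 = 2 * r + 2 + 2 by ring, this, pow_succ]; omega

lemma step1 (r : ℕ) : redBall (2 * r + 1) = redBall (2 * r) + 4 * 3 ^ r := by
  rw [redBall_eq, redBall_eq, Finset.sum_range_succ _ (2 * r + 1), ← N_odd, card_C,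
    if_neg (by simp [Nat.even_add_one])]; ring

lemma step2 (r : ℕ) : redBall (2 * r + 2) = redBall (2 * r + 1) + 8 * 3 ^ r := by
  rw [redBall_eq, redBall_eq, Finset.sum_range_succ _ (2 * r + 2), ← N_even, card_C,
    if_pos (by simp [Nat.even_add_one])]; ring

lemma even_formula (r : ℕ) : redBall (2 * r) + 6 = 6 * 3 ^ r := by
  induction r with
  | zero => rw [redBall_eq]; simp [N, C]
  | succ r ih =>
    have h1 := step1 r
    have h2 := step2 r
    rw [show 2 * (r + 1) = 2 * r + 2 by ring, pow_succ]; omega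

end RB

/-- The cumulative reducible count is `10·3^r − 6` at radius `2r+1` and
`2·3^(r+1) − 6` at radius `2r`. -/
theorem redBall_formula (r : ℕ) :
    redBall (2 * r + 1) = 10 * 3 ^ r - 6 ∧ redBall (2 * r) = 2 * 3 ^ (r + 1) - 6 := by
  have h1 := RB.step1 r
  have h2 := RB.even_formula r
  rw [pow_succ]
  omega
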